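/- Let η̃ : closure(Ω_0^f) → ℝ³ be C² and v : closure(Ω_0^f) → ℝ³ be C¹, both horizontally periodic, with v(x₁,x₂,h) = 0 for all (x₁,x₂). Let a(x) be the cofactor matrix of Id + Dη̃(x), and assume the Arbitrary-Lagrangian divergence-free condition ∑_{i,j=1}^{3} a_i^j(x)·∂_j v^i(x) = 0 for all x ∈ Ω_0^f. Then ∫_{(0,L)²} v³(x₁,x₂,h_s) dx₁dx₂ = ∫_{(0,L)²} ∑_{i=1}^{3} (δ_{i3} − a_i³(x₁,x₂,h_s))·v^i(x₁,x₂,h_s) dx₁dx₂, where δ_{i3} is the Kronecker delta. In particular, the average of the vertical velocity on the bottom face is quadratic in the perturbation (η̃, v). -/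

import Mathlib

/-- Jacobian matrix `(∂_j f^i)_{ij}` of a map `f : ℝ³ → ℝ³` written in the
three real coordinates `(x1, x2, x3)`. -/
noncomputable def jac3 (f : ℝ → ℝ → ℝ → (Fin 3 → ℝ)) (x1 x2 x3 : ℝ) :
    Matrix (Fin 3) (Fin 3) ℝ :=
  Matrix.of fun i j =>
    ![deriv (fun s => f s x2 x3 i) x1,
      deriv (fun s => f x1 s x3 i) x2,
      deriv (fun s => f x1 x2 s i) x3] j

/-- Cofactor matrix of a 3×3 matrix: the transpose of the adjugate, so that
`(Cof M)ᵀ * M = (det M) • 1`. -/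
noncomputable def cofactor3 (M : Matrix (Fin 3) (Fin 3) ℝ) : Matrix (Fin 3) (Fin 3) ℝ :=
  Matrix.transpose (Matrix.adjugate M)

open MeasureTheory intervalIntegral

/-- The standard basis of `ℝ × ℝ × ℝ`. -/
def stdBasis3 : Fin 3 → ℝ × ℝ × ℝ := ![(1, 0, 0), (0, 1, 0), (0, 0, 1)]

theorem contDiff_cofactor3_apply {E : Type*} [NormedAddCommGroup E] [NormedSpace ℝ E] {n : ℕ∞}
    {A : E → Matrix (Fin 3) (Fin 3) ℝ} (hA : ∀ i j, ContDiff ℝ n fun q => A q i j) (i j : Fin 3) :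
    ContDiff ℝ n fun q => cofactor3 (A q) i j := by
  fin_cases i <;> fin_cases j <;> simp [cofactor3, Matrix.adjugate_fin_three] <;> fun_prop

/-- **Piola's identity**: the rows of the cofactor matrix of a gradient are divergence free. -/
theorem piola_cofactor3 {E : Type*} [NormedAddCommGroup E] [NormedSpace ℝ E] {e : Fin 3 → E}
    {A : E → Matrix (Fin 3) (Fin 3) ℝ} {A' : Fin 3 → Fin 3 → E →L[ℝ] ℝ} {p : E}
    (hA : ∀ i j, HasFDerivAt (fun q => A q i j) (A' i j) p)
    (hcurl : ∀ i j k, A' i j (e k) = A' i k (e j)) (i : Fin 3) :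
    ∑ j, fderiv ℝ (fun q => cofactor3 (A q) i j) p (e j) = 0 := by
  have hminor (i j k l i' j' k' l' : Fin 3) :
      fderiv ℝ (fun q => A q i j * A q k l - A q i' j' * A q k' l') p =
        (A p i j • A' k l + A p k l • A' i j) -
          (A p i' j' • A' k' l' + A p k' l' • A' i' j') :=
    (((hA i j).mul (hA k l)).sub ((hA i' j').mul (hA k' l'))).fderiv
  have hneg (x y : ℝ) : -x + y = y - x := by ring
  fin_cases i <;>
    simp only [cofactor3, Matrix.adjugate_fin_three, Matrix.transpose_apply, Matrix.of_apply,
      Fin.sum_univ_three, Matrix.cons_val, Fin.zero_eta, Fin.mk_one, Fin.reduceFinMk, hneg,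
      hminor, _root_.sub_apply, _root_.add_apply,
      _root_.smul_apply, smul_eq_mul] <;>
    simp only [hcurl _ 1 0, hcurl _ 2 0, hcurl _ 2 1] <;> ring

theorem div_cofactor3_mul {E : Type*} [NormedAddCommGroup E] [NormedSpace ℝ E] {e : Fin 3 → E}
    {A : E → Matrix (Fin 3) (Fin 3) ℝ} (hA : ∀ i j, ContDiff ℝ 1 fun q => A q i j)
    {w : Fin 3 → E → ℝ} (hw : ∀ i, Differentiable ℝ (w i)) {p : E}
    (hcurl : ∀ i j k,
      fderiv ℝ (fun q => A q i j) p (e k) = fderiv ℝ (fun q => A q i k) p (e j)) :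
    ∑ j, fderiv ℝ (fun q => ∑ i, cofactor3 (A q) i j * w i q) p (e j) =
      ∑ i, ∑ j, cofactor3 (A p) i j * fderiv ℝ (w i) p (e j) := by
  have hC (i j) : DifferentiableAt ℝ (fun q => cofactor3 (A q) i j) p :=
    (contDiff_cofactor3_apply (n := 1) hA i j).differentiable (by simp) p
  have hP (i) := piola_cofactor3
    (fun i j => ((hA i j).differentiable (by simp) p).hasFDerivAt) hcurl i
  have hD (j) : fderiv ℝ (fun q => ∑ i, cofactor3 (A q) i j * w i q) p (e j) =
      ∑ i, (cofactor3 (A p) i j * fderiv ℝ (w i) p (e j) +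
        w i p * fderiv ℝ (fun q => cofactor3 (A q) i j) p (e j)) := by
    rw [(HasFDerivAt.fun_sum fun i _ => (hC i j).hasFDerivAt.fun_mul (hw i p).hasFDerivAt).fderiv]
    simp
  simp_rw [hD]
  rw [Finset.sum_comm]
  simp_rw [Finset.sum_add_distrib, ← Finset.mul_sum, hP]
  simp

theorem hasDerivAt_slice {F : ℝ × ℝ × ℝ → ℝ} {x1 x2 x3 : ℝ}
    (hF : DifferentiableAt ℝ F (x1, x2, x3)) :
    HasDerivAt (fun s => F (s, x2, x3)) (fderiv ℝ F (x1, x2, x3) (stdBasis3 0)) x1 ∧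
    HasDerivAt (fun s => F (x1, s, x3)) (fderiv ℝ F (x1, x2, x3) (stdBasis3 1)) x2 ∧
    HasDerivAt (fun s => F (x1, x2, s)) (fderiv ℝ F (x1, x2, x3) (stdBasis3 2)) x3 := by
  refine ⟨?_, ?_, ?_⟩
  · exact hF.hasFDerivAt.comp_hasDerivAt x1 (f := fun s => (s, x2, x3))
      ((hasDerivAt_id x1).prodMk ((hasDerivAt_const x1 x2).prodMk (hasDerivAt_const x1 x3)))
  · exact hF.hasFDerivAt.comp_hasDerivAt x2 (f := fun s => (x1, s, x3))
      ((hasDerivAt_const x2 x1).prodMk ((hasDerivAt_id x2).prodMk (hasDerivAt_const x2 x3)))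
  · exact hF.hasFDerivAt.comp_hasDerivAt x3 (f := fun s => (x1, x2, s))
      ((hasDerivAt_const x3 x1).prodMk ((hasDerivAt_const x3 x2).prodMk (hasDerivAt_id x3)))

theorem jac3_apply_eq_fderiv {f : ℝ → ℝ → ℝ → Fin 3 → ℝ}
    (hf : Differentiable ℝ fun p : ℝ × ℝ × ℝ => f p.1 p.2.1 p.2.2) (x1 x2 x3 : ℝ) (i j : Fin 3) :
    jac3 f x1 x2 x3 i j =
      fderiv ℝ (fun p : ℝ × ℝ × ℝ => f p.1 p.2.1 p.2.2 i) (x1, x2, x3) (stdBasis3 j) := by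
  obtain ⟨h0, h1, h2⟩ := hasDerivAt_slice (differentiable_pi.1 hf i (x1, x2, x3))
  fin_cases j
  · exact h0.deriv
  · exact h1.deriv
  · exact h2.deriv

theorem jac3_periodic {f : ℝ → ℝ → ℝ → Fin 3 → ℝ} {L : ℝ}
    (hf : ∀ x1 x2 x3, f (x1 + L) x2 x3 = f x1 x2 x3 ∧ f x1 (x2 + L) x3 = f x1 x2 x3)
    (x1 x2 x3 : ℝ) :
    jac3 f (x1 + L) x2 x3 = jac3 f x1 x2 x3 ∧ jac3 f x1 (x2 + L) x3 = jac3 f x1 x2 x3 := by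
  constructor <;> ext i j <;> fin_cases j <;>
    simp [jac3, hf, ← deriv_comp_add_const]

theorem intervalIntegral_swap_of_continuous {f : ℝ → ℝ → ℝ}
    (hf : Continuous fun p : ℝ × ℝ => f p.1 p.2) (a b c d : ℝ) :
    ∫ x in a..b, ∫ y in c..d, f x y = ∫ y in c..d, ∫ x in a..b, f x y :=
  intervalIntegral_intervalIntegral_swap
    ((hf.continuousOn.integrableOn_compact (isCompact_uIcc.prod isCompact_uIcc)).mono_set
      (Set.prod_mono Set.uIoc_subset_uIcc Set.uIoc_subset_uIcc))

/-- The flux through the bottom face of a divergence-free field vanishes if the field is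
horizontally periodic and has no vertical component on the top face. -/
theorem integral_bottom_flux_eq_zero {L a b : ℝ} (hL : 0 ≤ L) (hab : a ≤ b)
    {W : Fin 3 → ℝ × ℝ × ℝ → ℝ} (hW : ∀ j, ContDiff ℝ 1 (W j))
    (h0 : ∀ x2 x3, W 0 (L, x2, x3) = W 0 (0, x2, x3))
    (h1 : ∀ x1 x3, W 1 (x1, L, x3) = W 1 (x1, 0, x3))
    (htop : ∀ x1 x2, W 2 (x1, x2, b) = 0)
    (hdiv : ∀ x1 ∈ Set.Ioo 0 L, ∀ x2 ∈ Set.Ioo 0 L, ∀ x3 ∈ Set.Ioo a b,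
      ∑ j, fderiv ℝ (W j) (x1, x2, x3) (stdBasis3 j) = 0) :
    ∫ x1 in 0..L, ∫ x2 in 0..L, W 2 (x1, x2, a) = 0 := by
  have hc (j) : Continuous fun p => fderiv ℝ (W j) p (stdBasis3 j) :=
    ((hW j).continuous_fderiv (by simp)).clm_apply continuous_const
  have hs (j) (x1 x2 x3 : ℝ) :=
    hasDerivAt_slice (((hW j).differentiable (by simp)) (x1, x2, x3))
  have I0 : ∫ x1 in 0..L, ∫ x2 in 0..L, ∫ x3 in a..b,
      fderiv ℝ (W 0) (x1, x2, x3) (stdBasis3 0) = 0 := by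
    have hc0 := hc 0
    rw [intervalIntegral_swap_of_continuous (by fun_prop)]
    refine (integral_congr fun x2 _ => ?_).trans integral_zero
    rw [intervalIntegral_swap_of_continuous (by fun_prop)]
    refine (integral_congr fun x3 _ => ?_).trans integral_zero
    rw [integral_eq_sub_of_hasDerivAt (fun x1 _ => (hs 0 x1 x2 x3).1)
      (Continuous.intervalIntegrable (by fun_prop) _ _), h0, sub_self]
  have I1 : ∫ x1 in 0..L, ∫ x2 in 0..L, ∫ x3 in a..b,
      fderiv ℝ (W 1) (x1, x2, x3) (stdBasis3 1) = 0 := by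
    have hc1 := hc 1
    refine (integral_congr fun x1 _ => ?_).trans integral_zero
    rw [intervalIntegral_swap_of_continuous (by fun_prop)]
    refine (integral_congr fun x3 _ => ?_).trans integral_zero
    rw [integral_eq_sub_of_hasDerivAt (fun x2 _ => (hs 1 x1 x2 x3).2.1)
      (Continuous.intervalIntegrable (by fun_prop) _ _), h1, sub_self]
  have I2 : ∫ x1 in 0..L, ∫ x2 in 0..L, ∫ x3 in a..b,
      fderiv ℝ (W 2) (x1, x2, x3) (stdBasis3 2) =
        -∫ x1 in 0..L, ∫ x2 in 0..L, W 2 (x1, x2, a) := by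
    have hc2 := hc 2
    rw [← intervalIntegral.integral_neg]
    refine integral_congr fun x1 _ => ?_
    rw [← intervalIntegral.integral_neg]
    refine integral_congr fun x2 _ => ?_
    rw [integral_eq_sub_of_hasDerivAt (fun x3 _ => (hs 2 x1 x2 x3).2.2)
      (Continuous.intervalIntegrable (by fun_prop) _ _), htop, zero_sub]
  have hsum : ∫ x1 in 0..L, ∫ x2 in 0..L, ∫ x3 in a..b,
      ∑ j, fderiv ℝ (W j) (x1, x2, x3) (stdBasis3 j) = 0 := by
    refine (integral_congr_Ioo_of_le hL fun x1 hx1 => ?_).trans integral_zero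
    refine (integral_congr_Ioo_of_le hL fun x2 hx2 => ?_).trans integral_zero
    exact (integral_congr_Ioo_of_le hab fun x3 hx3 => hdiv x1 hx1 x2 hx2 x3 hx3).trans
      integral_zero
  have hsplit : ∫ x1 in 0..L, ∫ x2 in 0..L, ∫ x3 in a..b,
      ∑ j, fderiv ℝ (W j) (x1, x2, x3) (stdBasis3 j) =
      ∑ j, ∫ x1 in 0..L, ∫ x2 in 0..L, ∫ x3 in a..b,
        fderiv ℝ (W j) (x1, x2, x3) (stdBasis3 j) := by
    rw [← intervalIntegral.integral_finsetSum fun j _ =>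
      Continuous.intervalIntegrable (by have := hc j; fun_prop) _ _]
    refine integral_congr fun x1 _ => ?_
    rw [← intervalIntegral.integral_finsetSum fun j _ =>
      Continuous.intervalIntegrable (by have := hc j; fun_prop) _ _]
    refine integral_congr fun x2 _ => ?_
    exact intervalIntegral.integral_finsetSum fun j _ =>
      Continuous.intervalIntegrable (by have := hc j; fun_prop) _ _
  rw [hsplit, Fin.sum_univ_three, I0, I1, I2] at hsum
  linarith

/-- under the Arbitrary-Lagrangian divergence-free condition
`∑_{i,j} a_i^j ∂_j v^i = 0` in `Ω_0^f = (0,L)² × (h_s,h)` (with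
`a = Cof(Id + Dη̃)`), horizontal periodicity, and `v = 0` on the top face, the
average of the vertical velocity on the bottom face is quadratic in the
perturbation `(η̃, v)`. -/
theorem stmt_15 (L hs h : ℝ) (hL : 0 < L) (hhs : 0 < hs) (hsh : hs < h)
    (eta : ℝ → ℝ → ℝ → (Fin 3 → ℝ)) (v : ℝ → ℝ → ℝ → (Fin 3 → ℝ))
    (heta : ContDiff ℝ 2 (fun p : ℝ × ℝ × ℝ => eta p.1 p.2.1 p.2.2))
    (hv : ContDiff ℝ 1 (fun p : ℝ × ℝ × ℝ => v p.1 p.2.1 p.2.2))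
    (hetaper : ∀ x1 x2 x3 : ℝ,
      eta (x1 + L) x2 x3 = eta x1 x2 x3 ∧ eta x1 (x2 + L) x3 = eta x1 x2 x3)
    (hvper : ∀ x1 x2 x3 : ℝ,
      v (x1 + L) x2 x3 = v x1 x2 x3 ∧ v x1 (x2 + L) x3 = v x1 x2 x3)
    (htop : ∀ x1 x2 : ℝ, v x1 x2 h = 0)
    (hdiv : ∀ x1 ∈ Set.Ioo (0:ℝ) L, ∀ x2 ∈ Set.Ioo (0:ℝ) L, ∀ x3 ∈ Set.Ioo hs h,
      ∑ i : Fin 3, ∑ j : Fin 3,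
        cofactor3 (1 + jac3 eta x1 x2 x3) i j * jac3 v x1 x2 x3 i j = 0) :
    (∫ x1 in (0:ℝ)..L, ∫ x2 in (0:ℝ)..L, v x1 x2 hs 2)
      = ∫ x1 in (0:ℝ)..L, ∫ x2 in (0:ℝ)..L,
          ∑ i : Fin 3,
            ((if i = (2 : Fin 3) then (1:ℝ) else 0)
                - cofactor3 (1 + jac3 eta x1 x2 hs) i 2) * v x1 x2 hs i := by
  set A : ℝ × ℝ × ℝ → Matrix (Fin 3) (Fin 3) ℝ := fun q => 1 + jac3 eta q.1 q.2.1 q.2.2 with hA_def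
  set w : Fin 3 → ℝ × ℝ × ℝ → ℝ := fun i q => v q.1 q.2.1 q.2.2 i with hw_def
  set W : Fin 3 → ℝ × ℝ × ℝ → ℝ := fun j q => ∑ i, cofactor3 (A q) i j * w i q with hW_def
  have heta_i (i : Fin 3) := contDiff_pi.1 heta i
  have hw (i : Fin 3) : ContDiff ℝ 1 (w i) := contDiff_pi.1 hv i
  have hentry (i j : Fin 3) : (fun q => A q i j) = fun q => (1 : Matrix (Fin 3) (Fin 3) ℝ) i j +
      fderiv ℝ (fun p : ℝ × ℝ × ℝ => eta p.1 p.2.1 p.2.2 i) q (stdBasis3 j) := by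
    ext q
    simp only [hA_def, Matrix.add_apply,
      jac3_apply_eq_fderiv (heta.differentiable (by simp))]
  have hA (i j : Fin 3) : ContDiff ℝ 1 fun q => A q i j := by
    rw [hentry]
    exact contDiff_const.add
      (((heta_i i).fderiv_right (m := 1) (by norm_num)).clm_apply contDiff_const)
  have hcurl (p : ℝ × ℝ × ℝ) (i j k : Fin 3) :
      fderiv ℝ (fun q => A q i j) p (stdBasis3 k) =
        fderiv ℝ (fun q => A q i k) p (stdBasis3 j) := by
    have hD : DifferentiableAt ℝ
        (fderiv ℝ fun p : ℝ × ℝ × ℝ => eta p.1 p.2.1 p.2.2 i) p :=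
      ((heta_i i).fderiv_right (m := 1) (by norm_num)).differentiable (by simp) p
    have key (u : ℝ × ℝ × ℝ) (c : ℝ) :=
      (hD.hasFDerivAt.clm_apply (hasFDerivAt_const u p)).const_add c
    rw [hentry, hentry, (key _ _).fderiv, (key _ _).fderiv]
    simpa using (heta_i i).contDiffAt.isSymmSndFDerivAt (x := p) (by simp) _ _
  have hW (j : Fin 3) : ContDiff ℝ 1 (W j) :=
    ContDiff.sum fun i _ => (contDiff_cofactor3_apply (n := 1) hA i j).mul (hw i)
  have hflux : ∫ x1 in (0:ℝ)..L, ∫ x2 in (0:ℝ)..L, W 2 (x1, x2, hs) = 0 := by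
    refine integral_bottom_flux_eq_zero hL.le hsh.le hW (fun x2 x3 => ?_) (fun x1 x3 => ?_)
      (fun x1 x2 => ?_) fun x1 hx1 x2 hx2 x3 hx3 => ?_
    · have hJ := (jac3_periodic hetaper 0 x2 x3).1
      have hV := (hvper 0 x2 x3).1
      rw [zero_add] at hJ hV
      simp [hW_def, hA_def, hw_def, hJ, hV]
    · have hJ := (jac3_periodic hetaper x1 0 x3).2
      have hV := (hvper x1 0 x3).2
      rw [zero_add] at hJ hV
      simp [hW_def, hA_def, hw_def, hJ, hV]
    · simp [hW_def, hw_def, htop]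
    · rw [div_cofactor3_mul hA (fun i => (hw i).differentiable (by simp)) (hcurl _),
        ← hdiv x1 hx1 x2 hx2 x3 hx3]
      simp only [jac3_apply_eq_fderiv (hv.differentiable (by simp)), hA_def, hw_def]
  have hWc := (hW 2).continuous
  have hwc := (hw 2).continuous
  have hpt (x1 x2 : ℝ) : ∑ i : Fin 3, ((if i = (2 : Fin 3) then (1:ℝ) else 0)
      - cofactor3 (1 + jac3 eta x1 x2 hs) i 2) * v x1 x2 hs i =
      w 2 (x1, x2, hs) - W 2 (x1, x2, hs) := by
    simp [hW_def, hA_def, hw_def, sub_mul, Finset.sum_sub_distrib]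
  have hinner (x1 : ℝ) : ∫ x2 in (0:ℝ)..L, (w 2 (x1, x2, hs) - W 2 (x1, x2, hs)) =
      (∫ x2 in (0:ℝ)..L, w 2 (x1, x2, hs)) - ∫ x2 in (0:ℝ)..L, W 2 (x1, x2, hs) :=
    intervalIntegral.integral_sub (Continuous.intervalIntegrable (by fun_prop) _ _)
      (Continuous.intervalIntegrable (by fun_prop) _ _)
  simp_rw [hpt, hinner]
  rw [intervalIntegral.integral_sub (Continuous.intervalIntegrable (by fun_prop) _ _)
      (Continuous.intervalIntegrable (by fun_prop) _ _), hflux, sub_zero]
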